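/- Let s(τ) = −27·η(3τ)¹²/η(τ)¹² for τ in the upper half-plane ℍ. Then the Atkin–Lehner involution w₃ : τ ↦ −1/(3τ) sends s to its reciprocal: for every τ ∈ ℍ, s(−1/(3τ)) = 1/s(τ). In particular, the function τ ↦ s(τ)/(1−s(τ))² is invariant under τ ↦ −1/(3τ) at every τ ∈ ℍ with s(τ) ≠ 1. -/

import Mathlib

/- STATEMENT 18: the Atkin–Lehner involution `w₃ : τ ↦ −1/(3τ)` sends
`s(τ) = −27 η(3τ)¹²/η(τ)¹²` to `1/s(τ)`; in particular `s/(1−s)²` is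
invariant under `w₃` wherever `s ≠ 1`. -/

open Complex

/-- `q = e^{2πiτ}`. -/
noncomputable def qpar (τ : ℂ) : ℂ := Complex.exp (2 * (Real.pi : ℂ) * Complex.I * τ)

/-- Dedekind eta function `η(τ) = q^{1/24} ∏_{n≥1} (1 − qⁿ)`, `q^{1/24} = e^{2πiτ/24}`. -/
noncomputable def dedekindEta (τ : ℂ) : ℂ :=
  Complex.exp (2 * (Real.pi : ℂ) * Complex.I * τ / 24) * ∏' n : ℕ, (1 - qpar τ ^ (n + 1))

/-- `s(τ) = −27 η(3τ)¹²/η(τ)¹²`. -/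
noncomputable def sfun (τ : ℂ) : ℂ :=
  -27 * dedekindEta (3 * τ) ^ 12 / dedekindEta τ ^ 12

theorem dedekindEta_eq_eta (τ : ℂ) : dedekindEta τ = ModularForm.eta τ := by
  simp [dedekindEta, ModularForm.eta, qpar, ModularForm.eta_q, Function.Periodic.qParam]

theorem dedekindEta_ne_zero {τ : ℂ} (hτ : 0 < τ.im) : dedekindEta τ ≠ 0 := by
  rw [dedekindEta_eq_eta]
  exact ModularForm.eta_ne_zero hτ

theorem Complex.sqrt_pow_twelve {z : ℂ} (hz : z ≠ 0) : sqrt z ^ 12 = z ^ 6 := by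
  rw [sqrt_eq_exp hz, ← exp_nat_mul, show ((12 : ℕ) : ℂ) * (log z / 2) = (6 : ℕ) * log z by
    push_cast; ring, exp_nat_mul, exp_log hz]

theorem dedekindEta_neg_one_div_pow_twelve {τ : ℂ} (hτ : 0 < τ.im) :
    dedekindEta (-1 / τ) ^ 12 = -τ ^ 6 * dedekindEta τ ^ 12 := by
  have hτ0 : τ ≠ 0 := by rintro rfl; simp at hτ
  have h : ModularForm.eta (-1 / τ) = (sqrt I)⁻¹ * (sqrt τ * ModularForm.eta τ) := by
    simpa using ModularForm.eta_comp_eq_csqrt_I_inv hτ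
  have hI : I ^ 6 = -1 := by
    rw [show I ^ 6 = (I ^ 2) ^ 3 by ring, I_sq]
    norm_num
  rw [dedekindEta_eq_eta, dedekindEta_eq_eta, h, mul_pow, mul_pow, inv_pow,
    sqrt_pow_twelve I_ne_zero, sqrt_pow_twelve hτ0, hI]
  norm_num

theorem sfun_ne_zero {τ : ℂ} (hτ : 0 < τ.im) : sfun τ ≠ 0 := by
  have h3 : dedekindEta (3 * τ) ≠ 0 := dedekindEta_ne_zero (by simpa using hτ)
  exact div_ne_zero (mul_ne_zero (by norm_num) (pow_ne_zero _ h3))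
    (pow_ne_zero _ (dedekindEta_ne_zero hτ))

theorem sfun_neg_one_div_three_mul {τ : ℂ} (hτ : 0 < τ.im) :
    sfun (-1 / (3 * τ)) = 1 / sfun τ := by
  have hτ0 : τ ≠ 0 := by rintro rfl; simp at hτ
  have hτ3 : 0 < (3 * τ).im := by simpa using hτ
  have h1 := dedekindEta_ne_zero hτ
  have h3 := dedekindEta_ne_zero hτ3
  rw [sfun, sfun, show 3 * (-1 / (3 * τ)) = -1 / τ by field_simp,
    dedekindEta_neg_one_div_pow_twelve hτ, dedekindEta_neg_one_div_pow_twelve hτ3]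
  field_simp
  norm_num

theorem stmt18 :
    (∀ τ : ℂ, 0 < τ.im → sfun (-1 / (3 * τ)) = 1 / sfun τ) ∧
    (∀ τ : ℂ, 0 < τ.im → sfun τ ≠ 1 →
      sfun (-1 / (3 * τ)) / (1 - sfun (-1 / (3 * τ))) ^ 2
        = sfun τ / (1 - sfun τ) ^ 2) := by
  refine ⟨fun τ hτ ↦ sfun_neg_one_div_three_mul hτ, fun τ hτ h1 ↦ ?_⟩
  have h0 := sfun_ne_zero hτ
  have h2 : 1 - sfun τ ≠ 0 := sub_ne_zero.mpr h1.symm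
  rw [sfun_neg_one_div_three_mul hτ, one_sub_div h0]
  field_simp
  ring
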